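/- Let p ∈ (2,∞) and β ∈ (0,1). Consider the weights on [0,1) given by w(x) = (1−β) x^{−β} and σ(x) = x^{β/(p−1)} for x ∈ (0,1) (w(0)=σ(0)=1). Then: (a) [w,σ]_{A_p} ≤ C(p) and, with q = (p+1)/2 and q' its Hölder conjugate, [σ]_{A_{q'}} ≤ C(p); (b) the operator norm of f ↦ S(fσ) from L^p(σ) to L^p(w) is at least c_p (1−β)^{1/p − 1/2}, where c_p > 0 depends only on p and S is the dyadic square function over [0,1). -/

import Mathlib

open MeasureTheory Set Filter
open scoped ENNReal NNReal

noncomputable section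

/-- Average of `g` over the interval `[a, b)` (with respect to Lebesgue measure). -/
def avgI (g : ℝ → ℝ) (a b : ℝ) : ℝ := (b - a)⁻¹ * ∫ x in Set.Ico a b, g x

/-- The dyadic interval `[k·2^{-n}, (k+1)·2^{-n})`. -/
def dyadicI (n k : ℤ) : Set ℝ :=
  Set.Ico ((k : ℝ) * (2:ℝ) ^ (-n)) (((k : ℝ) + 1) * (2:ℝ) ^ (-n))

/-- Average of `g` over the dyadic interval `dyadicI n k`. -/
def avgD (g : ℝ → ℝ) (n k : ℤ) : ℝ :=
  avgI g ((k : ℝ) * (2:ℝ) ^ (-n)) (((k : ℝ) + 1) * (2:ℝ) ^ (-n))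

/-- The martingale difference `Δ_Q g` associated with the dyadic interval `Q = dyadicI n k`:
`Δ_Q g = Σ_{R child of Q} ⟨g⟩_R 1_R − ⟨g⟩_Q 1_Q`. -/
def deltaD (g : ℝ → ℝ) (n k : ℤ) (x : ℝ) : ℝ :=
  (dyadicI (n+1) (2*k)).indicator (fun _ => avgD g (n+1) (2*k)) x
    + (dyadicI (n+1) (2*k+1)).indicator (fun _ => avgD g (n+1) (2*k+1)) x
    - (dyadicI n k).indicator (fun _ => avgD g n k) x

/-- The dyadic square function on `ℝ`. -/
def sqFn (g : ℝ → ℝ) (x : ℝ) : ℝ :=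
  Real.sqrt (∑' q : ℤ × ℤ, (deltaD g q.1 q.2 x) ^ 2)

open Classical in
/-- The dyadic square function over `[0,1)`: the sum runs only over dyadic intervals
contained in `[0,1)`. -/
def sqFn01 (g : ℝ → ℝ) (x : ℝ) : ℝ :=
  Real.sqrt (∑' q : ℤ × ℤ,
    if dyadicI q.1 q.2 ⊆ Set.Ico (0:ℝ) 1 then (deltaD g q.1 q.2 x) ^ 2 else 0)

/-- `‖g‖_{L^p(w)}` (as an extended nonnegative real), `w dx` being the underlying measure. -/
def pNorm (p : ℝ) (g w : ℝ → ℝ) : ℝ≥0∞ :=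
  (∫⁻ x : ℝ, ENNReal.ofReal (|g x| ^ p * w x)) ^ (1/p)

/-- `‖g‖_{L^p(w)}` over `[0,1)`. -/
def pNorm01 (p : ℝ) (g w : ℝ → ℝ) : ℝ≥0∞ :=
  (∫⁻ x in Set.Ico (0:ℝ) 1, ENNReal.ofReal (|g x| ^ p * w x)) ^ (1/p)

/-- The joint `A_p` characteristic `[w,σ]_{A_p}`, the supremum running over all bounded
intervals of `ℝ`. -/
def apChar (p : ℝ) (w σ : ℝ → ℝ) : ℝ≥0∞ :=
  ⨆ (a : ℝ) (b : ℝ) (_ : a < b),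
    ENNReal.ofReal (avgI w a b * (avgI σ a b) ^ (p - 1))

/-- The joint `A_p` characteristic `[w,σ]_{A_p}`, the supremum running over all
subintervals of `[0,1)`. -/
def apChar01 (p : ℝ) (w σ : ℝ → ℝ) : ℝ≥0∞ :=
  ⨆ (a : ℝ) (b : ℝ) (_ : 0 ≤ a) (_ : a < b) (_ : b ≤ 1),
    ENNReal.ofReal (avgI w a b * (avgI σ a b) ^ (p - 1))

/-- The local maximal function `M_{[a,b)} σ (x) = sup { ⟨σ⟩_R : R interval ⊆ [a,b), x ∈ R }`. -/
def maxFn (σ : ℝ → ℝ) (a b x : ℝ) : ℝ≥0∞ :=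
  ⨆ (c : ℝ) (e : ℝ) (_ : a ≤ c) (_ : c < e) (_ : e ≤ b) (_ : x ∈ Set.Ico c e),
    ENNReal.ofReal (avgI σ c e)

/-- The Fujii–Wilson `A_∞` characteristic
`[σ]_{A_∞} = sup_Q (1/σ(Q)) ∫_Q M_Q σ`, the supremum over bounded intervals of `ℝ`. -/
def ainfChar (σ : ℝ → ℝ) : ℝ≥0∞ :=
  ⨆ (a : ℝ) (b : ℝ) (_ : a < b),
    (∫⁻ x in Set.Ico a b, maxFn σ a b x) / ENNReal.ofReal (∫ x in Set.Ico a b, σ x)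

/-- A weight on `ℝ`: measurable, a.e. positive, integrable over every bounded interval. -/
def IsWeight (w : ℝ → ℝ) : Prop :=
  Measurable w ∧ (∀ᵐ x : ℝ, 0 < w x) ∧
    ∀ a b : ℝ, a < b → IntegrableOn w (Set.Ico a b)

/-- A weight on `[0,1)`: measurable, a.e. positive on `[0,1)`, integrable over `[0,1)`. -/
def IsWeight01 (w : ℝ → ℝ) : Prop :=
  Measurable w ∧ (∀ᵐ x : ℝ, x ∈ Set.Ico (0:ℝ) 1 → 0 < w x) ∧
    IntegrableOn w (Set.Ico (0:ℝ) 1)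


/-- The function alternating between `1` and `-1` on the intervals `[2^k, 2^(k+1))`, extended
by `0` to `(-∞, 0]`. -/
def logSign (x : ℝ) : ℝ := if 0 < x then (-1 : ℝ) ^ ⌊Real.logb 2 x⌋ else 0

theorem measurable_logSign : Measurable logSign := by
  have h : Measurable fun x : ℝ => (-1 : ℝ) ^ ⌊Real.logb 2 x⌋ :=
    (measurable_from_top (f := fun k : ℤ => (-1 : ℝ) ^ k)).comp
      (Int.measurable_floor.comp (Real.measurable_log.div_const _))
  exact Measurable.ite measurableSet_Ioi h measurable_const

theorem abs_logSign_of_pos {x : ℝ} (hx : 0 < x) : |logSign x| = 1 := by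
  simp [logSign, hx, abs_zpow]

theorem abs_logSign_le_one (x : ℝ) : |logSign x| ≤ 1 := by
  by_cases hx : 0 < x
  · exact (abs_logSign_of_pos hx).le
  · simp [logSign, hx]

theorem logSign_eq {n : ℤ} {x : ℝ} (hx : x ∈ Ico ((2 : ℝ) ^ (-(n + 1))) ((2 : ℝ) ^ (-n))) :
    logSign x = -(-1 : ℝ) ^ n := by
  have hx0 : 0 < x := lt_of_lt_of_le (by positivity) hx.1
  have hf : ⌊Real.logb 2 x⌋ = -(n + 1) := by
    rw [Int.floor_eq_iff]
    constructor
    · rw [Real.le_logb_iff_rpow_le one_lt_two hx0, Real.rpow_intCast]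
      exact hx.1
    · rw [Real.logb_lt_iff_lt_rpow one_lt_two hx0]
      have h2 : ((-(n + 1) : ℤ) : ℝ) + 1 = ((-n : ℤ) : ℝ) := by push_cast; ring
      rw [h2, Real.rpow_intCast]
      exact hx.2
  rw [logSign, if_pos hx0, hf, zpow_neg, ← inv_zpow, zpow_add₀ (by norm_num)]
  norm_num

theorem integrableOn_logSign (a b : ℝ) : IntegrableOn logSign (Ico a b) :=
  Integrable.of_bound measurable_logSign.aestronglyMeasurable 1
    (Eventually.of_forall abs_logSign_le_one)

theorem avgI_congr {g h : ℝ → ℝ} {a b : ℝ} (hgh : EqOn g h (Ioo a b)) :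
    avgI g a b = avgI h a b := by
  rw [avgI, avgI, integral_Ico_eq_integral_Ioo, integral_Ico_eq_integral_Ioo,
    setIntegral_congr_fun measurableSet_Ioo hgh]

theorem avgI_const {a b : ℝ} (hab : a < b) (c : ℝ) : avgI (fun _ => c) a b = c := by
  have : b - a ≠ 0 := (sub_pos.2 hab).ne'
  simp [avgI, hab.le]
  field_simp

theorem abs_avgI_le {g : ℝ → ℝ} {a b c : ℝ} (hab : a < b) (hg : ∀ x ∈ Ioo a b, |g x| ≤ c) :
    |avgI g a b| ≤ c := by
  have hpos : 0 < b - a := sub_pos.2 hab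
  have h := norm_setIntegral_le_of_norm_le_const (μ := volume) (s := Ioo a b) (f := g)
    measure_Ioo_lt_top hg
  rw [avgI, integral_Ico_eq_integral_Ioo, abs_mul, abs_of_pos (inv_pos.2 hpos),
    inv_mul_le_iff₀ hpos]
  simpa [hab.le, mul_comm] using h

theorem dyadic_length_pos (n k : ℤ) :
    (k : ℝ) * (2 : ℝ) ^ (-n) < ((k : ℝ) + 1) * (2 : ℝ) ^ (-n) := by
  have : (0 : ℝ) < (2 : ℝ) ^ (-n) := by positivity
  nlinarith

theorem zpow_neg_eq_two_mul (n : ℤ) : (2 : ℝ) ^ (-n) = 2 * (2 : ℝ) ^ (-(n + 1)) := by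
  rw [← zpow_one_add₀ two_ne_zero]
  congr 1
  ring

theorem avgD_eq_children {g : ℝ → ℝ} (hg : ∀ a b : ℝ, IntegrableOn g (Ico a b)) (n k : ℤ) :
    avgD g n k = (avgD g (n + 1) (2 * k) + avgD g (n + 1) (2 * k + 1)) / 2 := by
  have hpos : (0 : ℝ) < (2 : ℝ) ^ (-(n + 1)) := by positivity
  unfold avgD avgI
  rw [zpow_neg_eq_two_mul n]
  set d := (2 : ℝ) ^ (-(n + 1)) with hd
  push_cast
  have e1 : (k : ℝ) * (2 * d) = 2 * k * d := by ring
  have e2 : ((k : ℝ) + 1) * (2 * d) = (2 * k + 1 + 1) * d := by ring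
  have hun : Ico (2 * (k : ℝ) * d) ((2 * k + 1 + 1) * d)
      = Ico (2 * (k : ℝ) * d) ((2 * k + 1) * d) ∪ Ico ((2 * (k : ℝ) + 1) * d)
        ((2 * k + 1 + 1) * d) := by
    rw [Ico_union_Ico_eq_Ico] <;> nlinarith
  have hdis : Disjoint (Ico (2 * (k : ℝ) * d) ((2 * k + 1) * d))
      (Ico ((2 * (k : ℝ) + 1) * d) ((2 * k + 1 + 1) * d)) := by
    rw [Set.disjoint_left]
    intro x hx hy
    exact absurd hx.2 (not_lt.2 hy.1)
  rw [e1, e2, hun, setIntegral_union hdis measurableSet_Ico (hg _ _) (hg _ _)]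
  have l1 : (2 * (k : ℝ) + 1 + 1) * d - 2 * k * d = 2 * d := by ring
  have l2 : (2 * (k : ℝ) + 1) * d - 2 * k * d = d := by ring
  have l3 : (2 * (k : ℝ) + 1 + 1) * d - (2 * k + 1) * d = d := by ring
  rw [l1, l2, l3]
  field_simp

theorem mem_dyadicI_iff_children {n k : ℤ} {x : ℝ} :
    x ∈ dyadicI n k ↔ x ∈ dyadicI (n + 1) (2 * k) ∨ x ∈ dyadicI (n + 1) (2 * k + 1) := by
  have hpos : (0 : ℝ) < (2 : ℝ) ^ (-(n + 1)) := by positivity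
  simp only [dyadicI, mem_Ico]
  rw [zpow_neg_eq_two_mul n]
  push_cast
  set d := (2 : ℝ) ^ (-(n + 1)) with hd
  constructor
  · rintro ⟨h1, h2⟩
    rcases lt_or_ge x ((2 * (k : ℝ) + 1) * d) with h | h
    · exact Or.inl ⟨by linarith, h⟩
    · exact Or.inr ⟨h, by linarith⟩
  · rintro (⟨h1, h2⟩ | ⟨h1, h2⟩) <;> constructor <;> linarith

theorem notMem_right_of_mem_left {n k : ℤ} {x : ℝ} (h : x ∈ dyadicI (n + 1) (2 * k)) :
    x ∉ dyadicI (n + 1) (2 * k + 1) := by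
  intro h'
  have h1 := h.2
  have h2 := h'.1
  push_cast at h1 h2
  linarith

theorem deltaD_of_notMem {g : ℝ → ℝ} {n k : ℤ} {x : ℝ} (hx : x ∉ dyadicI n k) :
    deltaD g n k x = 0 := by
  have h := mt mem_dyadicI_iff_children.2 hx
  rw [not_or] at h
  simp [deltaD, hx, h.1, h.2]

theorem deltaD_of_mem_left {g : ℝ → ℝ} {n k : ℤ} {x : ℝ} (hx : x ∈ dyadicI (n + 1) (2 * k)) :
    deltaD g n k x = avgD g (n + 1) (2 * k) - avgD g n k := by
  simp [deltaD, hx, notMem_right_of_mem_left hx, mem_dyadicI_iff_children.2 (Or.inl hx)]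

theorem deltaD_of_mem_right {g : ℝ → ℝ} {n k : ℤ} {x : ℝ}
    (hx : x ∈ dyadicI (n + 1) (2 * k + 1)) :
    deltaD g n k x = avgD g (n + 1) (2 * k + 1) - avgD g n k := by
  have h : x ∉ dyadicI (n + 1) (2 * k) := fun h => notMem_right_of_mem_left h hx
  simp [deltaD, hx, h, mem_dyadicI_iff_children.2 (Or.inr hx)]

theorem avgD_of_eqOn_const {g : ℝ → ℝ} {n k : ℤ} {c : ℝ} (h : ∀ x ∈ dyadicI n k, g x = c) :
    avgD g n k = c := by
  rw [avgD, avgI_congr (h := fun _ => c) (fun x hx => h x (Ioo_subset_Ico_self hx)),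
    avgI_const (dyadic_length_pos n k)]

theorem deltaD_of_eqOn_const {g : ℝ → ℝ} {n k : ℤ} {c : ℝ} (h : ∀ x ∈ dyadicI n k, g x = c)
    (x : ℝ) : deltaD g n k x = 0 := by
  by_cases hx : x ∈ dyadicI n k
  · rcases mem_dyadicI_iff_children.1 hx with hl | hr
    · rw [deltaD_of_mem_left hl, avgD_of_eqOn_const h,
        avgD_of_eqOn_const fun y hy => h y (mem_dyadicI_iff_children.2 (Or.inl hy)), sub_self]
    · rw [deltaD_of_mem_right hr, avgD_of_eqOn_const h,
        avgD_of_eqOn_const fun y hy => h y (mem_dyadicI_iff_children.2 (Or.inr hy)), sub_self]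
  · exact deltaD_of_notMem hx

theorem avgD_logSign_succ_one (n : ℤ) : avgD logSign (n + 1) 1 = -(-1 : ℝ) ^ n := by
  refine avgD_of_eqOn_const fun x hx => logSign_eq ?_
  simp only [dyadicI, Int.cast_one, one_mul] at hx
  rw [zpow_neg_eq_two_mul n]
  norm_num at hx ⊢
  exact hx

theorem half_le_abs_avgD_logSign_sub (n : ℤ) :
    1 / 2 ≤ |avgD logSign (n + 1) 0 - avgD logSign n 0| := by
  have h1 := avgD_eq_children integrableOn_logSign n 0
  have h2 := avgD_eq_children integrableOn_logSign (n + 1) 0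
  simp only [mul_zero, zero_add, avgD_logSign_succ_one] at h1 h2
  have h3 : |avgD logSign (n + 1 + 1) 0| ≤ 1 :=
    abs_avgI_le (dyadic_length_pos _ _) fun x _ => abs_logSign_le_one x
  rw [abs_le] at h3
  rw [zpow_add₀ (by norm_num), zpow_one] at h2
  rw [le_abs]
  rcases Int.even_or_odd n with he | ho
  · rw [he.neg_one_zpow] at h1 h2
    left; linarith
  · rw [ho.neg_one_zpow] at h1 h2
    right; linarith

theorem quarter_le_deltaD_logSign_sq {n : ℤ} {x : ℝ} (hx0 : 0 < x)
    (hx : x < (2 : ℝ) ^ (-(n + 1))) : 1 / 4 ≤ deltaD logSign n 0 x ^ 2 := by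
  have hmem : x ∈ dyadicI (n + 1) (2 * 0) := by
    simp only [dyadicI, mem_Ico]
    norm_num at hx ⊢
    exact ⟨hx0.le, hx⟩
  rw [deltaD_of_mem_left hmem, mul_zero]
  have h := half_le_abs_avgD_logSign_sub n
  rw [← sq_abs]
  nlinarith

theorem nonneg_of_dyadicI_subset {n k : ℤ} (h : dyadicI n k ⊆ Ico (0 : ℝ) 1) : 0 ≤ n := by
  by_contra! hn
  have h2 : (2 : ℝ) ≤ (2 : ℝ) ^ (-n) := by
    calc (2 : ℝ) = (2 : ℝ) ^ (1 : ℤ) := by norm_num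
      _ ≤ _ := zpow_le_zpow_right₀ one_le_two (by omega)
  have h0 := (h (left_mem_Ico.2 (dyadic_length_pos n k))).1
  have h1 := (h (show (k : ℝ) * (2 : ℝ) ^ (-n) + 1 ∈ dyadicI n k from
    ⟨by linarith, by nlinarith⟩)).2
  linarith

theorem dyadicI_zero_subset (n : ℕ) : dyadicI n 0 ⊆ Ico (0 : ℝ) 1 := by
  intro x hx
  have h : (2 : ℝ) ^ (-(n : ℤ)) ≤ 1 := zpow_le_one_of_nonpos₀ one_le_two (by omega)
  simp only [dyadicI, mem_Ico, Int.cast_zero, zero_mul, zero_add, one_mul] at hx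
  exact ⟨hx.1, hx.2.trans_le h⟩

theorem le_log_scale_of_deltaD_logSign_ne_zero {m n k : ℤ} {x : ℝ}
    (hx : x ∈ Ico ((2 : ℝ) ^ (-(m + 1))) ((2 : ℝ) ^ (-m))) (h : deltaD logSign n k x ≠ 0) :
    n ≤ m ∧ k = 0 := by
  have hmem : x ∈ dyadicI n k := by
    by_contra hc
    exact h (deltaD_of_notMem hc)
  have hd : (0 : ℝ) < (2 : ℝ) ^ (-n) := by positivity
  have hx0 : 0 < x := lt_of_lt_of_le (by positivity) hx.1
  rcases le_or_gt n m with hnm | hnm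
  · refine ⟨hnm, ?_⟩
    have hmn : (2 : ℝ) ^ (-m) ≤ (2 : ℝ) ^ (-n) := zpow_le_zpow_right₀ one_le_two (by omega)
    have h1 : (k : ℝ) < 1 := by
      by_contra! hc
      have := hmem.1
      have := hx.2
      nlinarith
    have h2 : (0 : ℝ) < k + 1 := by
      by_contra! hc
      have := hmem.2
      nlinarith
    have h1' : k < 1 := by exact_mod_cast h1
    have h2' : 0 < k + 1 := by exact_mod_cast h2
    omega
  · refine absurd (deltaD_of_eqOn_const (c := -(-1 : ℝ) ^ m) (fun y hy => logSign_eq ?_) x) h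
    obtain ⟨j, hj⟩ := Int.eq_ofNat_of_zero_le (show 0 ≤ n - (m + 1) by omega)
    have e1 : (2 : ℝ) ^ (-(m + 1)) = ((2 ^ j : ℤ) : ℝ) * (2 : ℝ) ^ (-n) := by
      push_cast
      rw [← zpow_natCast, ← zpow_add₀ two_ne_zero]
      congr 1
      omega
    have hx1 := hx.1
    have hx2 := hx.2
    rw [zpow_neg_eq_two_mul m, e1] at hx2
    rw [zpow_neg_eq_two_mul m, e1]
    rw [e1] at hx1
    have k1 : ((2 ^ j : ℤ) : ℝ) < ((k + 1 : ℤ) : ℝ) := by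
      push_cast at *
      have := hmem.2
      by_contra! hc
      nlinarith
    have k2 : ((k : ℤ) : ℝ) < ((2 * 2 ^ j : ℤ) : ℝ) := by
      push_cast at *
      have := hmem.1
      by_contra! hc
      nlinarith
    have k1' : (((2 ^ j : ℤ)) : ℝ) ≤ (k : ℝ) := by
      exact_mod_cast Int.lt_add_one_iff.1 (Int.cast_lt.1 k1)
    have k2' : (k : ℝ) + 1 ≤ 2 * ((2 ^ j : ℤ) : ℝ) := by
      exact_mod_cast Int.add_one_le_iff.2 (Int.cast_lt.1 k2)
    constructor
    · have := hy.1
      nlinarith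
    · have := hy.2
      nlinarith

theorem sqrt_le_sqFn01_logSign (M : ℕ) {x : ℝ} (hx0 : 0 < x) (hx : x < (2 : ℝ) ^ (-(M : ℤ))) :
    Real.sqrt (M / 4) ≤ sqFn01 logSign x := by
  classical
  obtain ⟨l, hl⟩ := exists_mem_Ico_zpow hx0 one_lt_two
  have hm : x ∈ Ico ((2 : ℝ) ^ (-((-(l + 1)) + 1))) ((2 : ℝ) ^ (-(-(l + 1)))) := by
    simpa using hl
  unfold sqFn01
  refine Real.sqrt_le_sqrt ?_
  set F : ℤ × ℤ → ℝ := fun q =>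
    if dyadicI q.1 q.2 ⊆ Ico (0 : ℝ) 1 then deltaD logSign q.1 q.2 x ^ 2 else 0 with hF
  have hsum : Summable F := by
    refine summable_of_hasFiniteSupport
      (((Finset.Icc 0 (-(l + 1))) ×ˢ ({0} : Finset ℤ)).finite_toSet.subset ?_)
    intro q hq
    simp only [hF, Function.mem_support, ne_eq, ite_eq_right_iff, Classical.not_imp] at hq
    have h := le_log_scale_of_deltaD_logSign_ne_zero hm (pow_ne_zero_iff two_ne_zero |>.1 hq.2)
    simp only [Finset.mem_coe, Finset.mem_product, Finset.mem_Icc, Finset.mem_singleton]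
    exact ⟨⟨nonneg_of_dyadicI_subset hq.1, h.1⟩, h.2⟩
  have hinj : Function.Injective fun i : ℕ => ((i : ℤ), (0 : ℤ)) := by
    intro i j hij
    simpa using hij
  have hle := hsum.sum_le_tsum ((Finset.range M).map ⟨_, hinj⟩) (fun q _ => by
    simp only [hF]; split_ifs <;> positivity)
  refine le_trans ?_ hle
  rw [Finset.sum_map]
  calc (M : ℝ) / 4 = ∑ _i ∈ Finset.range M, (1 / 4 : ℝ) := by simp; ring
    _ ≤ _ := Finset.sum_le_sum fun i hi => ?_
  simp only [hF, Function.Embedding.coeFn_mk, dyadicI_zero_subset, if_true]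
  refine quarter_le_deltaD_logSign_sq hx0 (hx.trans_le (zpow_le_zpow_right₀ one_le_two ?_))
  have := Finset.mem_range.1 hi
  omega

theorem integral_Ico_rpow {a b r : ℝ} (hr : -1 < r) (hab : a ≤ b) :
    ∫ x in Ico a b, x ^ r = (b ^ (r + 1) - a ^ (r + 1)) / (r + 1) := by
  rw [integral_Ico_eq_integral_Ioo, ← integral_Ioc_eq_integral_Ioo,
    ← intervalIntegral.integral_of_le hab, integral_rpow (Or.inl hr)]

theorem avgI_rpow_neg_le {a b γ : ℝ} (ha : 0 ≤ a) (hab : a < b) (hγ0 : 0 ≤ γ) (hγ1 : γ < 1) :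
    (1 - γ) * avgI (fun x => x ^ (-γ)) a b ≤ b ^ (-γ) := by
  have hb : 0 < b := ha.trans_lt hab
  have hd : 0 < b - a := sub_pos.2 hab
  rw [avgI, integral_Ico_rpow (by linarith) hab.le, neg_add_eq_sub]
  have h1 : (1 - γ) * ((b - a)⁻¹ * ((b ^ (1 - γ) - a ^ (1 - γ)) / (1 - γ)))
      = (b - a)⁻¹ * (b ^ (1 - γ) - a ^ (1 - γ)) := by
    have : 1 - γ ≠ 0 := by linarith
    field_simp
  rw [h1, inv_mul_le_iff₀ hd]
  have hbg : b ^ (1 - γ) = b * b ^ (-γ) := by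
    rw [sub_eq_add_neg, Real.rpow_add hb, Real.rpow_one]
  have hag : a * b ^ (-γ) ≤ a ^ (1 - γ) := by
    rcases ha.eq_or_lt with rfl | ha'
    · rw [zero_mul]
      exact Real.rpow_nonneg le_rfl _
    · rw [sub_eq_add_neg 1 γ, Real.rpow_add ha', Real.rpow_one]
      exact mul_le_mul_of_nonneg_left
        (Real.rpow_le_rpow_of_nonpos ha' hab.le (by linarith)) ha
  rw [hbg]
  linarith

theorem avgI_rpow_le {a b γ : ℝ} (ha : 0 ≤ a) (hab : a < b) (hγ : 0 ≤ γ) :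
    avgI (fun x => x ^ γ) a b ≤ b ^ γ := by
  refine (le_abs_self _).trans (abs_avgI_le hab fun x hx => ?_)
  have hx0 : 0 ≤ x := ha.trans hx.1.le
  rw [abs_of_nonneg (Real.rpow_nonneg hx0 _)]
  exact Real.rpow_le_rpow hx0 hx.2.le hγ

theorem avgI_nonneg {g : ℝ → ℝ} {a b : ℝ} (hab : a < b) (hg : ∀ x ∈ Ioo a b, 0 ≤ g x) :
    0 ≤ avgI g a b := by
  rw [avgI, integral_Ico_eq_integral_Ioo]
  exact mul_nonneg (inv_nonneg.2 (sub_pos.2 hab).le) (setIntegral_nonneg measurableSet_Ioo hg)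

theorem apChar01_le {p C : ℝ} {w σ : ℝ → ℝ}
    (h : ∀ a b : ℝ, 0 ≤ a → a < b → avgI w a b * avgI σ a b ^ (p - 1) ≤ C) :
    apChar01 p w σ ≤ ENNReal.ofReal C := by
  simp only [apChar01, iSup_le_iff]
  exact fun a b ha hab _ => ENNReal.ofReal_le_ofReal (h a b ha hab)

theorem apChar01_power_weights_le {p β : ℝ} (hp : 1 < p) (hβ : β ∈ Ioo (0 : ℝ) 1) :
    apChar01 p (fun x => if x = 0 then 1 else (1 - β) * x ^ (-β))
      (fun x => if x = 0 then 1 else x ^ (β / (p - 1))) ≤ ENNReal.ofReal 1 := by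
  have hp1 : 0 < p - 1 := by linarith
  have hq : 0 ≤ β / (p - 1) := div_nonneg hβ.1.le hp1.le
  refine apChar01_le fun a b ha hab => ?_
  have hb : 0 < b := ha.trans_lt hab
  have hne : ∀ x ∈ Ioo a b, x ≠ 0 := fun x hx => (ha.trans_lt hx.1).ne'
  rw [avgI_congr (h := fun x => (1 - β) * x ^ (-β)) fun x hx => if_neg (hne x hx),
    avgI_congr (h := fun x => x ^ (β / (p - 1))) fun x hx => if_neg (hne x hx)]
  have hw : avgI (fun x => (1 - β) * x ^ (-β)) a b ≤ b ^ (-β) := by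
    refine le_of_eq_of_le ?_ (avgI_rpow_neg_le ha hab hβ.1.le hβ.2)
    simp only [avgI, integral_const_mul]
    ring
  have hσ0 : 0 ≤ avgI (fun x => x ^ (β / (p - 1))) a b :=
    avgI_nonneg hab fun x hx => Real.rpow_nonneg (ha.trans hx.1.le) _
  have hσ : avgI (fun x => x ^ (β / (p - 1))) a b ^ (p - 1) ≤ b ^ β := by
    refine (Real.rpow_le_rpow hσ0 (avgI_rpow_le ha hab hq) hp1.le).trans_eq ?_
    rw [← Real.rpow_mul hb.le, div_mul_cancel₀ _ hp1.ne']
  calc _ ≤ b ^ (-β) * b ^ β :=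
        mul_le_mul hw hσ (Real.rpow_nonneg hσ0 _) (Real.rpow_nonneg hb.le _)
    _ = 1 := by rw [← Real.rpow_add hb, neg_add_cancel, Real.rpow_zero]

theorem apChar01_dual_power_weight_le {p β : ℝ} (hp : 2 < p) (hβ : β ∈ Ioo (0 : ℝ) 1) :
    apChar01 (((p + 1) / 2) / ((p + 1) / 2 - 1))
      (fun x => if x = 0 then 1 else x ^ (β / (p - 1)))
      (fun x => (if x = 0 then 1 else x ^ (β / (p - 1))) ^
        (-(1 / ((((p + 1) / 2) / ((p + 1) / 2 - 1)) - 1)))) ≤ ENNReal.ofReal 4 := by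
  have hp1 : 0 < p - 1 := by linarith
  have hq : 0 ≤ β / (p - 1) := div_nonneg hβ.1.le hp1.le
  have he : ((p + 1) / 2) / ((p + 1) / 2 - 1) - 1 = 2 / (p - 1) := by
    have : (p + 1) / 2 - 1 = (p - 1) / 2 := by ring
    rw [this]
    field_simp
    ring
  refine apChar01_le fun a b ha hab => ?_
  rw [he]
  have hb : 0 < b := ha.trans_lt hab
  have hne : ∀ x ∈ Ioo a b, x ≠ 0 := fun x hx => (ha.trans_lt hx.1).ne'
  rw [avgI_congr (h := fun x => x ^ (β / (p - 1))) fun x hx => if_neg (hne x hx),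
    avgI_congr (g := fun x => (if x = 0 then 1 else x ^ (β / (p - 1))) ^ (-(1 / (2 / (p - 1)))))
      (h := fun x => x ^ (-(β / 2))) fun x hx => by
      simp only [if_neg (hne x hx)]
      rw [← Real.rpow_mul (ha.trans hx.1.le)]
      congr 1
      field_simp]
  have hs := avgI_rpow_le ha hab hq
  have hτ0 : 0 ≤ avgI (fun x => x ^ (-(β / 2))) a b :=
    avgI_nonneg hab fun x hx => Real.rpow_nonneg (ha.trans hx.1.le) _
  have hτ1 : avgI (fun x => x ^ (-(β / 2))) a b ≤ 2 * b ^ (-(β / 2)) := by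
    have h := avgI_rpow_neg_le (γ := β / 2) ha hab (by linarith [hβ.1]) (by linarith [hβ.2])
    nlinarith [hβ.2]
  have hb2 : 0 ≤ b ^ (-(β / 2)) := Real.rpow_nonneg hb.le _
  have h2 : (2 : ℝ) ^ (2 / (p - 1)) ≤ 4 := by
    calc (2 : ℝ) ^ (2 / (p - 1)) ≤ 2 ^ (2 : ℝ) :=
          Real.rpow_le_rpow_of_exponent_le one_le_two (by rw [div_le_iff₀ hp1]; linarith)
      _ = 4 := by norm_num
  have hτ : avgI (fun x => x ^ (-(β / 2))) a b ^ (2 / (p - 1)) ≤ 4 * b ^ (-(β / (p - 1))) := by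
    calc _ ≤ (2 * b ^ (-(β / 2))) ^ (2 / (p - 1)) :=
          Real.rpow_le_rpow hτ0 hτ1 (by positivity)
      _ = 2 ^ (2 / (p - 1)) * b ^ (-(β / (p - 1))) := by
          rw [Real.mul_rpow zero_le_two hb2, ← Real.rpow_mul hb.le]
          congr 2
          field_simp
      _ ≤ _ := mul_le_mul_of_nonneg_right h2 (Real.rpow_nonneg hb.le _)
  calc _ ≤ b ^ (β / (p - 1)) * (4 * b ^ (-(β / (p - 1)))) :=
        mul_le_mul hs hτ (Real.rpow_nonneg hτ0 _) (Real.rpow_nonneg hb.le _)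
    _ = 4 * (b ^ (β / (p - 1)) * b ^ (-(β / (p - 1)))) := by ring
    _ = 4 := by rw [← Real.rpow_add hb, add_neg_cancel, Real.rpow_zero, mul_one]

theorem setLIntegral_Ioo_rpow_neg {b β : ℝ} (hb : 0 ≤ b) (hβ : β < 1) :
    ∫⁻ x in Ioo 0 b, ENNReal.ofReal (x ^ (-β)) = ENNReal.ofReal (b ^ (1 - β) / (1 - β)) := by
  have hint : IntegrableOn (fun x : ℝ => x ^ (-β)) (Ioo 0 b) :=
    (((intervalIntegrable_iff_integrableOn_Ioc_of_le hb).1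
      (intervalIntegral.intervalIntegrable_rpow' (by linarith))).mono_set Ioo_subset_Ioc_self)
  rw [← ofReal_integral_eq_lintegral_ofReal hint
    ((ae_restrict_iff' measurableSet_Ioo).2
      (Eventually.of_forall fun x hx => Real.rpow_nonneg hx.1.le _)),
    ← integral_Ico_eq_integral_Ioo, integral_Ico_rpow (by linarith) hb, neg_add_eq_sub,
    Real.zero_rpow (by linarith), sub_zero]

theorem pNorm01_logSign_div_weight {p β : ℝ} (hp : 1 < p) (hβ : β < 1) :
    pNorm01 p (fun x => logSign x * (x ^ (β / (p - 1)))⁻¹)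
      (fun x => if x = 0 then 1 else x ^ (β / (p - 1)))
      = ENNReal.ofReal ((1 - β) ^ (-(1 / p))) := by
  have hε : 0 < 1 - β := by linarith
  have hp1 : 0 < p - 1 := by linarith
  have h : ∫⁻ x in Ico (0 : ℝ) 1, ENNReal.ofReal
      (|logSign x * (x ^ (β / (p - 1)))⁻¹| ^ p * (if x = 0 then 1 else x ^ (β / (p - 1))))
      = ENNReal.ofReal (1 - β)⁻¹ := by
    rw [setLIntegral_congr Ioo_ae_eq_Ico.symm,
      setLIntegral_congr_fun (g := fun x => ENNReal.ofReal (x ^ (-β))) measurableSet_Ioo,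
      setLIntegral_Ioo_rpow_neg zero_le_one hβ, Real.one_rpow, one_div]
    intro x hx
    have hx0 : 0 < x := hx.1
    simp only [if_neg hx0.ne', abs_mul, abs_logSign_of_pos hx0, one_mul, abs_inv,
      abs_of_pos (Real.rpow_pos_of_pos hx0 _)]
    rw [← Real.rpow_neg hx0.le, ← Real.rpow_mul hx0.le, ← Real.rpow_add hx0]
    congr 2
    field_simp
    ring
  rw [pNorm01, h, ENNReal.ofReal_rpow_of_pos (inv_pos.2 hε), Real.inv_rpow hε.le,
    Real.rpow_neg hε.le]

theorem le_pNorm01_sqFn01_logSign {p β : ℝ} (hp : 1 < p) (hβ : β ∈ Ioo (0 : ℝ) 1) :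
    ENNReal.ofReal (1 / 8 * (1 - β) ^ (-(1 / 2 : ℝ))) ≤
      pNorm01 p (sqFn01 logSign) (fun x => if x = 0 then 1 else (1 - β) * x ^ (-β)) := by
  have hε : 0 < 1 - β := by linarith [hβ.2]
  set ε := 1 - β with hεdef
  have hp0 : 0 < p := by linarith
  set M := ⌈ε⁻¹⌉₊ with hM
  set δ := (2 : ℝ) ^ (-(M : ℤ)) with hδ
  have hδ0 : 0 < δ := by positivity
  have hδ1 : δ ≤ 1 := zpow_le_one_of_nonpos₀ one_le_two (by omega)
  have hM1 : ε⁻¹ ≤ M := Nat.le_ceil _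
  have hM2 : (M : ℝ) * ε ≤ 2 := by
    have h := (Nat.ceil_lt_add_one (inv_pos.2 hε).le).le
    have h' : (M : ℝ) * ε ≤ (ε⁻¹ + 1) * ε := mul_le_mul_of_nonneg_right h hε.le
    rw [add_mul, inv_mul_cancel₀ hε.ne'] at h'
    linarith [hβ.1]
  set s := 1 / 2 * ε ^ (-(1 / 2 : ℝ)) with hs
  have hs0 : 0 ≤ s := by positivity
  have hS : ∀ x ∈ Ioo 0 δ, s ≤ sqFn01 logSign x := by
    intro x hx
    refine le_trans ?_ (sqrt_le_sqFn01_logSign M hx.1 hx.2)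
    refine Real.le_sqrt_of_sq_le ?_
    have : (ε ^ (-(1 / 2 : ℝ))) ^ 2 = ε⁻¹ := by
      rw [← Real.rpow_natCast, ← Real.rpow_mul hε.le, ← Real.rpow_neg_one]
      norm_num
    rw [hs, mul_pow, this]
    linarith
  have hmass : (1 / 4 : ℝ) ≤ δ ^ ε := by
    have h1 : δ ^ ε = (2 : ℝ) ^ (-(M * ε)) := by
      rw [hδ, ← Real.rpow_intCast, ← Real.rpow_mul zero_le_two]
      push_cast
      congr 1
      ring
    rw [h1]
    calc (1 / 4 : ℝ) = (2 : ℝ) ^ (-2 : ℝ) := by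
          rw [Real.rpow_neg zero_le_two]; norm_num
      _ ≤ _ := Real.rpow_le_rpow_of_exponent_le one_le_two (by linarith)
  have hint : ENNReal.ofReal (s ^ p * (1 / 4)) ≤ ∫⁻ x in Ico (0 : ℝ) 1,
      ENNReal.ofReal (|sqFn01 logSign x| ^ p * (if x = 0 then 1 else ε * x ^ (-β))) := by
    calc ENNReal.ofReal (s ^ p * (1 / 4)) ≤ ENNReal.ofReal (s ^ p * ε * (δ ^ ε / ε)) := by
          refine ENNReal.ofReal_le_ofReal ?_
          have : s ^ p * ε * (δ ^ ε / ε) = s ^ p * δ ^ ε := by field_simp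
          rw [this]
          exact mul_le_mul_of_nonneg_left hmass (Real.rpow_nonneg hs0 _)
      _ = ∫⁻ x in Ioo 0 δ, ENNReal.ofReal (s ^ p * ε) * ENNReal.ofReal (x ^ (-β)) := by
          rw [lintegral_const_mul _ (by fun_prop), setLIntegral_Ioo_rpow_neg hδ0.le hβ.2,
            ENNReal.ofReal_mul (by positivity)]
      _ ≤ ∫⁻ x in Ioo 0 δ,
          ENNReal.ofReal (|sqFn01 logSign x| ^ p * (if x = 0 then 1 else ε * x ^ (-β))) := by
          refine setLIntegral_mono' measurableSet_Ioo fun x hx => ?_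
          rw [← ENNReal.ofReal_mul (by positivity), if_neg hx.1.ne', mul_assoc]
          refine ENNReal.ofReal_le_ofReal (mul_le_mul_of_nonneg_right ?_
            (mul_nonneg hε.le (Real.rpow_nonneg hx.1.le _)))
          exact Real.rpow_le_rpow hs0 ((hS x hx).trans (le_abs_self _)) hp0.le
      _ ≤ _ := lintegral_mono_set fun x (hx : x ∈ Ioo 0 δ) =>
          (⟨hx.1.le, hx.2.trans_le hδ1⟩ : x ∈ Ico (0 : ℝ) 1)
  refine le_trans ?_ (ENNReal.rpow_le_rpow hint (one_div_pos.2 hp0).le)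
  rw [ENNReal.ofReal_rpow_of_nonneg (by positivity) (by positivity)]
  refine ENNReal.ofReal_le_ofReal ?_
  rw [Real.mul_rpow (by positivity) (by positivity), ← Real.rpow_mul hs0,
    mul_one_div_cancel hp0.ne', Real.rpow_one]
  have h4 : (1 / 4 : ℝ) ≤ (1 / 4) ^ (1 / p) := by
    calc (1 / 4 : ℝ) = (1 / 4) ^ (1 : ℝ) := (Real.rpow_one _).symm
      _ ≤ _ := Real.rpow_le_rpow_of_exponent_ge (by norm_num) (by norm_num)
        (by rw [div_le_one hp0]; exact hp.le)
  calc 1 / 8 * ε ^ (-(1 / 2 : ℝ)) = s * (1 / 4) := by rw [hs]; ring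
    _ ≤ _ := mul_le_mul_of_nonneg_left h4 hs0

/-- For `p ∈ (2,∞)`, `β ∈ (0,1)`, and the weights on `[0,1)` given by
`w(x) = (1-β) x^{-β}`, `σ(x) = x^{β/(p-1)}` (value `1` at `0`): (a) `[w,σ]_{A_p} ≤ C(p)`
and, with `q = (p+1)/2` and `q'` its Hölder conjugate, `[σ]_{A_{q'}} ≤ C(p)`;
(b) the operator norm of `f ↦ S(fσ) : L^p(σ) → L^p(w)` is at least
`c_p (1-β)^{1/p - 1/2}`, where `S` is the dyadic square function over `[0,1)`. -/
theorem statement17 (p : ℝ) (hp : 2 < p) :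
    ∃ C > (0:ℝ), ∃ c > (0:ℝ), ∀ β ∈ Set.Ioo (0:ℝ) 1,
      apChar01 p (fun x => if x = 0 then 1 else (1 - β) * x ^ (-β))
          (fun x => if x = 0 then 1 else x ^ (β/(p - 1))) ≤ ENNReal.ofReal C ∧
      apChar01 (((p+1)/2) / ((p+1)/2 - 1))
          (fun x => if x = 0 then 1 else x ^ (β/(p - 1)))
          (fun x =>
            (if x = 0 then 1 else x ^ (β/(p - 1))) ^
              (-(1 / ((((p+1)/2) / ((p+1)/2 - 1)) - 1)))) ≤ ENNReal.ofReal C ∧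
      ∀ Cop : ℝ≥0∞,
        (∀ f : ℝ → ℝ, Measurable f →
          pNorm01 p
              (sqFn01 (fun x => f x * (if x = 0 then 1 else x ^ (β/(p - 1)))))
              (fun x => if x = 0 then 1 else (1 - β) * x ^ (-β)) ≤
            Cop * pNorm01 p f (fun x => if x = 0 then 1 else x ^ (β/(p - 1)))) →
        ENNReal.ofReal (c * (1 - β) ^ (1/p - 1/2)) ≤ Cop := by
  refine ⟨4, by norm_num, 1 / 8, by norm_num, fun β hβ =>
    ⟨(apChar01_power_weights_le (by linarith) hβ).trans
      (ENNReal.ofReal_le_ofReal (by norm_num)), apChar01_dual_power_weight_le hp hβ,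
      fun Cop hCop => ?_⟩⟩
  have hε : 0 < 1 - β := by linarith [hβ.2]
  have h := hCop (fun x => logSign x * (x ^ (β / (p - 1)))⁻¹)
    (measurable_logSign.mul (by fun_prop))
  have hfun : (fun x : ℝ => logSign x * (x ^ (β / (p - 1)))⁻¹ *
      (if x = 0 then 1 else x ^ (β / (p - 1)))) = logSign := by
    funext x
    by_cases hx : 0 < x
    · rw [if_neg hx.ne', mul_assoc, inv_mul_cancel₀ (Real.rpow_pos_of_pos hx _).ne', mul_one]
    · simp [logSign, hx]
  rw [hfun, pNorm01_logSign_div_weight (by linarith) hβ.2] at h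
  have h' := (le_pNorm01_sqFn01_logSign (by linarith) hβ).trans h
  have hpos : 0 < (1 - β) ^ (-(1 / p)) := Real.rpow_pos_of_pos hε _
  rw [← ENNReal.mul_le_mul_iff_left (ENNReal.ofReal_pos.2 hpos).ne' ENNReal.ofReal_ne_top,
    ← ENNReal.ofReal_mul (by positivity), mul_assoc, ← Real.rpow_add hε,
    show 1 / p - 1 / 2 + -(1 / p) = -(1 / 2) by ring]
  exact h'

end
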